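/- Let z ∈ ℂ and suppose there exists μ > 0 with |z| ≤ μ/Ψ(μ). Define Π_z : [0,∞) → [0,∞] by Π_z(x) = |z|·Ψ(x), and let Π_z^n denote its n-fold composition with itself. Then: (i) the sequence (Π_z^n(μ))_{n≥1} is nonincreasing and converges to a limit Π_z^∞(μ) which is a fixed point of Π_z, i.e. Π_z(Π_z^∞(μ)) = Π_z^∞(μ); (ii) the chain of inequalities |z|·𝓑(|z|) ≤ Π_z^∞(μ) ≤ ⋯ ≤ Π_z^{n+1}(μ) ≤ Π_z^n(μ) ≤ ⋯ ≤ Π_z(μ) ≤ μ holds. -/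

import Mathlib

open MeasureTheory ENNReal
open scoped Classical

noncomputable section

/-- Pair weight `w(x,y) = exp(-β φ(x-y))`, with `exp(-(+∞)) = 0`. -/
def pairW {d : ℕ} (β : ℝ) (φ : (Fin d → ℝ) → ℝ≥0∞) (x y : Fin d → ℝ) : ℝ :=
  if φ (x - y) = ∞ then 0 else Real.exp (-(β * (φ (x - y)).toReal))

/-- Truncated weight `ω^T_n`: sum over connected graphs on `{1,…,n}`. -/
def omegaT {S : Type*} (w : S → S → ℝ) (n : ℕ) (x : Fin n → S) : ℝ :=
  ∑ G : SimpleGraph (Fin n),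
    if G.Connected then
      ∏ p ∈ Finset.univ.filter (fun p : Fin n × Fin n => p.1 < p.2 ∧ G.Adj p.1 p.2),
        (w (x p.1) (x p.2) - 1)
    else 0

/-- `φ_n(x; x_1,…,x_n) = Π_i (1 - w(x,x_i)) Π_{i<j} w(x_i,x_j)`. -/
def phiVertex {S : Type*} (w : S → S → ℝ) (n : ℕ) (x : S) (y : Fin n → S) : ℝ :=
  (∏ i, (1 - w x (y i))) *
    ∏ p ∈ Finset.univ.filter (fun p : Fin n × Fin n => p.1 < p.2), w (y p.1) (y p.2)

/-- `g(n) = ∫_{ℝ^{dn}} φ_n(0; x_1,…,x_n) dx`. -/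
def gCoef {d : ℕ} (β : ℝ) (φ : (Fin d → ℝ) → ℝ≥0∞) (n : ℕ) : ℝ≥0∞ :=
  ∫⁻ y : Fin n → Fin d → ℝ, ENNReal.ofReal (phiVertex (pairW β φ) n 0 y)

/-- The vertex sum `Ψ(t) = 1 + Σ_{n≥1} g(n) t^n/n!` (extended to `t ∈ [0,∞]`). -/
def vertexSum {d : ℕ} (β : ℝ) (φ : (Fin d → ℝ) → ℝ≥0∞) (t : ℝ≥0∞) : ℝ≥0∞ :=
  1 + ∑' n : ℕ, gCoef β φ (n + 1) * t ^ (n + 1) / ((n + 1).factorial : ℝ≥0∞)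

/-- The children of vertex `i` in a tree on `{0,…,n}` rooted at `0`. -/
def childrenF {n : ℕ} (τ : SimpleGraph (Fin (n + 1))) (i : Fin (n + 1)) :
    Finset (Fin (n + 1)) :=
  Finset.univ.filter (fun j => τ.Adj i j ∧ τ.dist 0 j = τ.dist 0 i + 1)

/-- `φ_{|t|}(x; (y_j)_{j∈t})`, the vertex weight of `x` with the family of children `t`. -/
def phiFinset {S : Type*} {n : ℕ} (w : S → S → ℝ) (x : S)
    (t : Finset (Fin n)) (y : Fin n → S) : ℝ :=
  (∏ j ∈ t, (1 - w x (y j))) *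
    ∏ p ∈ (t ×ˢ t).filter (fun p => p.1 < p.2), w (y p.1) (y p.2)

/-- `B_n(x_0; x_1,…,x_n)`: sum over trees rooted at `0` of the product of vertex weights. -/
def treeB {S : Type*} (w : S → S → ℝ) (n : ℕ) (x : Fin (n + 1) → S) : ℝ :=
  ∑ τ : SimpleGraph (Fin (n + 1)),
    if τ.IsTree then ∏ i : Fin (n + 1), phiFinset w (x i) (childrenF τ i) x else 0

/-- The tree sum `𝓑(r) = 1 + Σ_{n≥1} (r^n/n!) ∫ B_n(0;x_1,…,x_n) dx`. -/
def treeSum {d : ℕ} (β : ℝ) (φ : (Fin d → ℝ) → ℝ≥0∞) (r : ℝ) : ℝ≥0∞ :=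
  1 + ∑' n : ℕ, ENNReal.ofReal (r ^ (n + 1) / (n + 1).factorial) *
    ∫⁻ y : Fin (n + 1) → Fin d → ℝ,
      ENNReal.ofReal (treeB (pairW β φ) (n + 1) (Fin.cons 0 y))

/-- The map `Π_z(t) = |z|·Ψ(t)`. -/
def PiMap {d : ℕ} (β : ℝ) (φ : (Fin d → ℝ) → ℝ≥0∞) (z : ℂ) : ℝ≥0∞ → ℝ≥0∞ :=
  fun t => ENNReal.ofReal ‖z‖ * vertexSum β φ t

/-- `p` is the parent map of a rooted forest with root set `R` and non-root vertices `Y`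
(the function `h` certifies acyclicity). -/
def IsForest {N : ℕ} (R Y : Finset (Fin N)) (p : Fin N → Fin N) : Prop :=
  (∀ v ∉ Y, p v = v) ∧ (∀ v ∈ Y, p v ∈ R ∪ Y) ∧ ∃ h : Fin N → ℕ, ∀ v ∈ Y, h (p v) < h v

/-- Sum over forests with root set `R` and non-root vertices `Y` of the product of the weights
`Φ i (children of i)`. -/
def forestSum {N : ℕ} (Φ : Fin N → Finset (Fin N) → ℝ≥0∞) (R Y : Finset (Fin N)) : ℝ≥0∞ :=
  ∑ p : Fin N → Fin N with IsForest R Y p, ∏ i ∈ R ∪ Y, Φ i (Y.filter (fun v => p v = i))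

lemma sum_le_sum_of_injOn {ι κ : Type*} {s : Finset ι} {t : Finset κ} {f : ι → ℝ≥0∞}
    {g : κ → ℝ≥0∞} (e : ι → κ) (he : ∀ i ∈ s, e i ∈ t) (hinj : Set.InjOn e s)
    (hfg : ∀ i ∈ s, f i ≤ g (e i)) : ∑ i ∈ s, f i ≤ ∑ j ∈ t, g j :=
  calc ∑ i ∈ s, f i ≤ ∑ i ∈ s, g (e i) := Finset.sum_le_sum hfg
    _ = ∑ j ∈ s.image e, g j := (Finset.sum_image hinj).symm
    _ ≤ ∑ j ∈ t, g j := Finset.sum_le_sum_of_subset (by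
        intro j hj
        obtain ⟨i, hi, rfl⟩ := Finset.mem_image.1 hj
        exact he i hi)

lemma forestSum_empty_le {N : ℕ} (Φ : Fin N → Finset (Fin N) → ℝ≥0∞) (Y : Finset (Fin N)) :
    forestSum Φ ∅ Y ≤ if Y = ∅ then 1 else 0 := by
  split_ifs with hY
  · subst hY
    have : (Finset.univ.filter (fun p : Fin N → Fin N => IsForest ∅ ∅ p)) ⊆ {id} := by
      intro p hp
      simp only [Finset.mem_filter, Finset.mem_univ, true_and] at hp
      simp only [Finset.mem_singleton]
      exact funext fun v => hp.1 v (by simp)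
    simpa [forestSum] using Finset.card_le_card this
  · have : (Finset.univ.filter (fun p : Fin N → Fin N => IsForest ∅ Y p)) = ∅ := by
      refine Finset.filter_eq_empty_iff.2 fun p _ hp => ?_
      obtain ⟨-, h2, h, h3⟩ := hp
      obtain ⟨v, hv, hmin⟩ := Y.exists_min_image h (Finset.nonempty_iff_ne_empty.2 hY)
      have h4 := h2 v hv
      rw [Finset.empty_union] at h4
      exact absurd (hmin _ h4) (not_le.2 (h3 v hv))
    simp [forestSum, this]

/-- Exploring the children of one root. -/
lemma forestSum_le {N : ℕ} (Φ : Fin N → Finset (Fin N) → ℝ≥0∞) {R Y : Finset (Fin N)}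
    (hRY : Disjoint R Y) {a : Fin N} (ha : a ∈ R) :
    forestSum Φ R Y ≤
      ∑ S ∈ Y.powerset, Φ a S * forestSum Φ (R.erase a ∪ S) (Y \ S) := by
  have haY : a ∉ Y := Finset.disjoint_left.1 hRY ha
  unfold forestSum
  rw [← Finset.sum_fiberwise_of_maps_to (t := Y.powerset)
    (g := fun p : Fin N → Fin N => Y.filter (fun v => p v = a))
    (fun p _ => Finset.mem_powerset.2 (Finset.filter_subset _ _))]
  refine Finset.sum_le_sum fun S hS => ?_
  rw [Finset.mul_sum]
  rw [Finset.mem_powerset] at hS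
  refine sum_le_sum_of_injOn (fun p v => if v ∈ S then v else p v) ?_ ?_ ?_
  · intro p hp
    simp only [Finset.mem_filter, Finset.mem_univ, true_and] at hp ⊢
    obtain ⟨⟨h1, h2, h, h3⟩, h4⟩ := hp
    refine ⟨?_, ?_, h, ?_⟩
    · grind
    · intro v hv
      have := h2 v (by grind)
      have : p v ≠ a := by
        rw [← h4] at hv
        grind
      grind
    · grind
  · intro p hp q hq hpq
    simp only [Finset.coe_filter, Set.mem_ofPred_eq, Finset.mem_filter, Finset.mem_univ,
      true_and] at hp hq
    funext v
    have := congrFun hpq v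
    by_cases hv : v ∈ S
    · have h1 : v ∈ Y.filter (fun v => p v = a) := hp.2 ▸ hv
      have h2 : v ∈ Y.filter (fun v => q v = a) := hq.2 ▸ hv
      grind
    · simpa [hv] using this
  · intro p hp
    simp only [Finset.mem_filter, Finset.mem_univ, true_and] at hp
    obtain ⟨⟨h1, h2, h, h3⟩, h4⟩ := hp
    have hset : R ∪ Y = insert a (R.erase a ∪ S ∪ Y \ S) := by
      ext v; grind
    rw [hset, Finset.prod_insert (by grind), h4]
    gcongr with i hi
    refine le_of_eq ?_
    congr 1
    ext v
    grind

open SimpleGraph in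
lemma parent_unique {N : ℕ} {τ : SimpleGraph (Fin (N + 1))} (hτ : τ.IsTree)
    {i j v : Fin (N + 1)} (hi : v ∈ childrenF τ i) (hj : v ∈ childrenF τ j) : i = j := by
  simp only [childrenF, Finset.mem_filter, Finset.mem_univ, true_and] at hi hj
  obtain ⟨p, hp⟩ := hτ.connected.exists_walk_length_eq_dist 0 i
  obtain ⟨q, hq⟩ := hτ.connected.exists_walk_length_eq_dist 0 j
  have hp' : (p.concat hi.1).IsPath :=
    Walk.isPath_of_length_eq_dist _ (by rw [Walk.length_concat, hp, hi.2])
  have hq' : (q.concat hj.1).IsPath :=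
    Walk.isPath_of_length_eq_dist _ (by rw [Walk.length_concat, hq, hj.2])
  have := (hτ.existsUnique_path 0 v).unique hp' hq'
  simpa using congrArg Walk.penultimate this

open SimpleGraph in
lemma exists_parent {N : ℕ} {τ : SimpleGraph (Fin (N + 1))} (hτ : τ.IsTree)
    {v : Fin (N + 1)} (hv : v ≠ 0) : ∃ i, v ∈ childrenF τ i := by
  obtain ⟨p, hp⟩ := hτ.connected.exists_walk_length_eq_dist v 0
  cases p with
  | nil => exact absurd rfl hv
  | @cons _ i _ h q =>
    refine ⟨i, ?_⟩
    simp only [childrenF, Finset.mem_filter, Finset.mem_univ, true_and]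
    refine ⟨h.symm, ?_⟩
    have h1 := τ.dist_le q
    have h2 := hτ.dist_eq_dist_add_one_of_adj 0 h
    rw [Walk.length_cons] at hp
    rw [dist_comm] at h1 hp
    omega

/-- The parent map of a tree rooted at `0`. -/
def parentMap {N : ℕ} (τ : SimpleGraph (Fin (N + 1))) (v : Fin (N + 1)) : Fin (N + 1) :=
  if h : v ≠ 0 ∧ ∃ i, v ∈ childrenF τ i then h.2.choose else v

lemma parentMap_zero {N : ℕ} (τ : SimpleGraph (Fin (N + 1))) : parentMap τ 0 = 0 := by
  simp [parentMap]

lemma mem_childrenF_iff {N : ℕ} {τ : SimpleGraph (Fin (N + 1))} (hτ : τ.IsTree)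
    {i v : Fin (N + 1)} : v ∈ childrenF τ i ↔ v ≠ 0 ∧ parentMap τ v = i := by
  have key : ∀ hv : v ≠ 0, v ∈ childrenF τ (parentMap τ v) := by
    intro hv
    have h : v ≠ 0 ∧ ∃ i, v ∈ childrenF τ i := ⟨hv, exists_parent hτ hv⟩
    rw [parentMap, dif_pos h]
    exact h.2.choose_spec
  constructor
  · intro h
    have hv : v ≠ 0 := by
      rintro rfl
      simp [childrenF] at h
    exact ⟨hv, parent_unique hτ (key hv) h⟩
  · rintro ⟨hv, rfl⟩
    exact key hv

lemma adj_iff_mem_childrenF {N : ℕ} {τ : SimpleGraph (Fin (N + 1))} (hτ : τ.IsTree)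
    {i j : Fin (N + 1)} : τ.Adj i j ↔ j ∈ childrenF τ i ∨ i ∈ childrenF τ j := by
  simp only [childrenF, Finset.mem_filter, Finset.mem_univ, true_and]
  constructor
  · intro h
    rcases hτ.dist_eq_dist_add_one_of_adj 0 h with h' | h'
    · exact Or.inr ⟨h.symm, h'⟩
    · exact Or.inl ⟨h, h'⟩
  · rintro (h | h)
    · exact h.1
    · exact h.1.symm

lemma isForest_parentMap {N : ℕ} {τ : SimpleGraph (Fin (N + 1))} (hτ : τ.IsTree) :
    IsForest {0} (Finset.univ.erase 0) (parentMap τ) := by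
  refine ⟨?_, ?_, fun v => τ.dist 0 v, ?_⟩
  · intro v hv
    obtain rfl : v = 0 := by simpa using hv
    exact parentMap_zero τ
  · intro v _
    by_cases h : parentMap τ v = 0 <;> simp [h]
  · intro v hv
    have := (mem_childrenF_iff hτ).2 ⟨(Finset.mem_erase.1 hv).1, rfl⟩
    simp only [childrenF, Finset.mem_filter, Finset.mem_univ, true_and] at this
    dsimp only
    omega

lemma sum_isTree_le_forestSum {N : ℕ} (Φ : Fin (N + 1) → Finset (Fin (N + 1)) → ℝ≥0∞) :
    ∑ τ : SimpleGraph (Fin (N + 1)) with τ.IsTree, ∏ i, Φ i (childrenF τ i) ≤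
      forestSum Φ {0} (Finset.univ.erase 0) := by
  refine sum_le_sum_of_injOn parentMap ?_ ?_ ?_
  · intro τ hτ
    simp only [Finset.mem_filter, Finset.mem_univ, true_and] at hτ ⊢
    exact isForest_parentMap hτ
  · intro τ hτ σ hσ h
    simp only [Finset.coe_filter, Finset.mem_univ, true_and, Set.mem_ofPred_eq] at hτ hσ
    ext i j
    simp only [adj_iff_mem_childrenF hτ, adj_iff_mem_childrenF hσ, mem_childrenF_iff hτ,
      mem_childrenF_iff hσ, h]
  · intro τ hτ
    simp only [Finset.mem_filter, Finset.mem_univ, true_and] at hτ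
    have : ({0} ∪ Finset.univ.erase 0 : Finset (Fin (N + 1))) = Finset.univ := by
      ext v; by_cases h : v = 0 <;> simp [h]
    rw [this]
    refine le_of_eq (Finset.prod_congr rfl fun i _ => ?_)
    congr 1
    ext v
    simp [mem_childrenF_iff hτ]

/-- Integrated forest weights with `k` roots and `m` non-root vertices, divided by `m!`, for
vertex coefficients `g`. -/
def forestCoef (g : ℕ → ℝ≥0∞) : ℕ → ℕ → ℝ≥0∞
  | 0, m => if m = 0 then 1 else 0
  | k + 1, m => ∑ s : Fin (m + 1), g s / ((s : ℕ).factorial : ℝ≥0∞) * forestCoef g (k + s) (m - s)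
termination_by k m => k + m
decreasing_by omega

lemma forestCoef_zero (g : ℕ → ℝ≥0∞) (m : ℕ) : forestCoef g 0 m = if m = 0 then 1 else 0 := by
  rw [forestCoef]

lemma forestCoef_succ (g : ℕ → ℝ≥0∞) (k m : ℕ) :
    forestCoef g (k + 1) m = ∑ s ∈ Finset.range (m + 1),
      g s / (s.factorial : ℝ≥0∞) * forestCoef g (k + s) (m - s) := by
  rw [forestCoef, Finset.sum_range]

/-- If `L` is a supersolution of `r * ∑ g s * L ^ s / s! ≤ L`, the truncated generating function
of forests with `k` roots is at most `L ^ k`. -/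
lemma sum_forestCoef_le (g : ℕ → ℝ≥0∞) (r L : ℝ≥0∞)
    (hL : r * ∑' s, g s * L ^ s / (s.factorial : ℝ≥0∞) ≤ L) (N k : ℕ) :
    ∑ m ∈ Finset.range (N - k), forestCoef g k m * r ^ (k + m) ≤ L ^ k := by
  induction N generalizing k with
  | zero => simp
  | succ N ih =>
    cases k with
    | zero =>
      simp [forestCoef_zero]
    | succ k =>
      calc ∑ m ∈ Finset.range (N + 1 - (k + 1)), forestCoef g (k + 1) m * r ^ (k + 1 + m)
          = ∑ m ∈ Finset.range (N - k), ∑ s ∈ Finset.range (m + 1),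
              (r * (g s / (s.factorial : ℝ≥0∞))) *
                (forestCoef g (k + s) (m - s) * r ^ (k + s + (m - s))) := by
            rw [Nat.add_sub_add_right]
            refine Finset.sum_congr rfl fun m _ => ?_
            rw [forestCoef_succ, Finset.sum_mul]
            refine Finset.sum_congr rfl fun s hs => ?_
            have : k + 1 + m = k + s + (m - s) + 1 := by
              have := Finset.mem_range.1 hs
              omega
            rw [this, pow_succ]
            ring
        _ = ∑ s ∈ Finset.range (N - k), ∑ j ∈ Finset.range (N - k - s),
              (r * (g s / (s.factorial : ℝ≥0∞))) *
                (forestCoef g (k + s) j * r ^ (k + s + j)) :=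
            Finset.sum_range_diag_flip (N - k) fun s j =>
              (r * (g s / (s.factorial : ℝ≥0∞))) * (forestCoef g (k + s) j * r ^ (k + s + j))
        _ ≤ ∑ s ∈ Finset.range (N - k), (r * (g s / (s.factorial : ℝ≥0∞))) * L ^ (k + s) := by
            refine Finset.sum_le_sum fun s _ => ?_
            rw [← Finset.mul_sum, Nat.sub_sub]
            gcongr
            exact ih (k + s)
        _ = L ^ k * (r * ∑ s ∈ Finset.range (N - k), g s * L ^ s / (s.factorial : ℝ≥0∞)) := by
            rw [Finset.mul_sum, Finset.mul_sum]
            refine Finset.sum_congr rfl fun s _ => ?_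
            rw [pow_add]
            simp only [div_eq_mul_inv]
            ring
        _ ≤ L ^ (k + 1) := by
            rw [pow_succ]
            gcongr
            refine le_trans ?_ hL
            gcongr
            exact ENNReal.sum_le_tsum _

section Weights

variable {d : ℕ} (β : ℝ) (φ : (Fin d → ℝ) → ℝ≥0∞)

lemma pairW_nonneg (x y : Fin d → ℝ) : 0 ≤ pairW β φ x y := by
  unfold pairW
  split_ifs <;> positivity

lemma pairW_le_one (hβ : 0 < β) (x y : Fin d → ℝ) : pairW β φ x y ≤ 1 := by
  unfold pairW
  split_ifs
  · exact zero_le_one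
  · rw [Real.exp_le_one_iff]
    have : 0 ≤ β * (φ (x - y)).toReal := by positivity
    linarith

lemma pairW_add_right (x y a : Fin d → ℝ) : pairW β φ (x + a) (y + a) = pairW β φ x y := by
  simp [pairW]

lemma measurable_pairW (hφ : Measurable φ) :
    Measurable fun q : (Fin d → ℝ) × (Fin d → ℝ) => pairW β φ q.1 q.2 := by
  have h : Measurable fun q : (Fin d → ℝ) × (Fin d → ℝ) => φ (q.1 - q.2) :=
    hφ.comp (measurable_fst.sub measurable_snd)
  unfold pairW
  refine Measurable.ite (h (measurableSet_singleton _)) measurable_const ?_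
  fun_prop

lemma phiFinset_nonneg (hβ : 0 < β) {N : ℕ} (x : Fin d → ℝ) (t : Finset (Fin N))
    (y : Fin N → Fin d → ℝ) : 0 ≤ phiFinset (pairW β φ) x t y :=
  mul_nonneg (Finset.prod_nonneg fun _ _ => sub_nonneg.2 (pairW_le_one β φ hβ _ _))
    (Finset.prod_nonneg fun _ _ => pairW_nonneg β φ _ _)

/-- The `ℝ≥0∞`-valued vertex weights of the configuration `x`. -/
def vertexWeight {N : ℕ} (x : Fin N → Fin d → ℝ) (i : Fin N) (t : Finset (Fin N)) : ℝ≥0∞ :=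
  ENNReal.ofReal (phiFinset (pairW β φ) (x i) t x)

lemma measurable_vertexWeight (hφ : Measurable φ) {N : ℕ} (i : Fin N) (t : Finset (Fin N)) :
    Measurable fun x : Fin N → Fin d → ℝ => vertexWeight β φ x i t := by
  have h : ∀ a b : Fin N, Measurable fun x : Fin N → Fin d → ℝ => pairW β φ (x a) (x b) :=
    fun a b => by
      have hab : Measurable fun x : Fin N → Fin d → ℝ => (x a, x b) := by fun_prop
      exact (measurable_pairW β φ hφ).comp hab
  unfold vertexWeight phiFinset
  refine ENNReal.measurable_ofReal.comp (Measurable.mul ?_ ?_)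
  · exact Finset.measurable_prod _ fun j _ => measurable_const.sub (h _ _)
  · exact Finset.measurable_prod _ fun p _ => h _ _

lemma measurable_forestSum (hφ : Measurable φ) {N : ℕ} (R Y : Finset (Fin N)) :
    Measurable fun x : Fin N → Fin d → ℝ => forestSum (vertexWeight β φ x) R Y :=
  Finset.measurable_sum _ fun _ _ => Finset.measurable_prod _ fun _ _ =>
    measurable_vertexWeight β φ hφ _ _

lemma vertexWeight_congr {N : ℕ} {x x' : Fin N → Fin d → ℝ} {i : Fin N} {t : Finset (Fin N)}
    (hi : x i = x' i) (ht : ∀ j ∈ t, x j = x' j) :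
    vertexWeight β φ x i t = vertexWeight β φ x' i t := by
  unfold vertexWeight phiFinset
  congr 2
  · exact Finset.prod_congr rfl fun j hj => by rw [hi, ht j hj]
  · refine Finset.prod_congr rfl fun p hp => ?_
    obtain ⟨h1, h2⟩ := Finset.mem_product.1 (Finset.mem_filter.1 hp).1
    rw [ht _ h1, ht _ h2]

/-- Marginal integrals written over `Fin k`-indexed families. -/
lemma lmarginal_eq_lintegral {N k : ℕ} (S : Finset (Fin N)) (e : Fin k ≃ S)
    (f : (Fin N → Fin d → ℝ) → ℝ≥0∞) (x : Fin N → Fin d → ℝ) :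
    (∫⋯∫⁻_S, f ∂fun _ => volume) x =
      ∫⁻ y : Fin k → Fin d → ℝ, f (Function.updateFinset x S fun i => y (e.symm i)) := by
  unfold lmarginal
  have h := measurePreserving_piCongrLeft (fun _ : S => (volume : Measure (Fin d → ℝ))) e
  rw [← h.lintegral_comp_emb (MeasurableEquiv.measurableEmbedding _)]
  refine lintegral_congr fun y => ?_
  congr 2
  funext i
  obtain ⟨j, rfl⟩ := e.surjective i
  rw [MeasurableEquiv.piCongrLeft_apply_apply, e.symm_apply_apply]

lemma vertexWeight_updateFinset {N k : ℕ} (S : Finset (Fin N)) (e : Fin k ≃o S) {a : Fin N}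
    (ha : a ∉ S) (x : Fin N → Fin d → ℝ) (y : Fin k → Fin d → ℝ) :
    vertexWeight β φ (Function.updateFinset x S fun i => y (e.symm i)) a S =
      ENNReal.ofReal (phiVertex (pairW β φ) k (x a) y) := by
  have hu : ∀ i : Fin k, Function.updateFinset x S (fun i => y (e.symm i)) (e i) = y i := by
    intro i
    simp [Function.updateFinset]
  unfold vertexWeight phiFinset phiVertex
  congr 2
  · rw [← Finset.prod_coe_sort S, ← e.toEquiv.prod_comp]
    refine Finset.prod_congr rfl fun i _ => ?_
    have : Function.updateFinset x S (fun i => y (e.symm i)) a = x a := by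
      simp [Function.updateFinset, ha]
    rw [this]
    congr 2
    exact hu i
  · symm
    refine Finset.prod_bij (fun p _ => ((e p.1 : Fin N), (e p.2 : Fin N))) ?_ ?_ ?_ ?_
    · intro p hp
      simpa using hp
    · intro p _ q _ h
      simp only [Prod.mk.injEq, Subtype.coe_inj, EmbeddingLike.apply_eq_iff_eq] at h
      exact Prod.ext h.1 h.2
    · intro p hp
      simp only [Finset.mem_filter, Finset.mem_product] at hp
      refine ⟨(e.symm ⟨p.1, hp.1.1⟩, e.symm ⟨p.2, hp.1.2⟩), ?_, ?_⟩
      · simpa using hp.2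
      · simp
    · intro p _
      simp only [hu]

lemma lintegral_phiVertex (k : ℕ) (a : Fin d → ℝ) :
    ∫⁻ y : Fin k → Fin d → ℝ, ENNReal.ofReal (phiVertex (pairW β φ) k a y) = gCoef β φ k := by
  unfold gCoef
  rw [← lintegral_add_right_eq_self
    (fun y : Fin k → Fin d → ℝ => ENNReal.ofReal (phiVertex (pairW β φ) k a y)) (fun _ => a)]
  refine lintegral_congr fun y => ?_
  congr 1
  unfold phiVertex
  congr 1
  · refine Finset.prod_congr rfl fun i _ => ?_
    rw [Pi.add_apply, ← pairW_add_right β φ 0 (y i) a, zero_add]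
  · refine Finset.prod_congr rfl fun p _ => ?_
    exact pairW_add_right β φ _ _ a

lemma lmarginal_vertexWeight {N : ℕ} (S : Finset (Fin N)) {a : Fin N} (ha : a ∉ S)
    (x : Fin N → Fin d → ℝ) :
    (∫⋯∫⁻_S, (fun x => vertexWeight β φ x a S) ∂fun _ => volume) x = gCoef β φ S.card := by
  rw [lmarginal_eq_lintegral S (S.orderIsoOfFin rfl).toEquiv, ← lintegral_phiVertex β φ _ (x a)]
  exact lintegral_congr fun y => vertexWeight_updateFinset β φ S (S.orderIsoOfFin rfl) ha x y

lemma lmarginal_forestSum_le (hφ : Measurable φ) {N : ℕ} (n : ℕ) :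
    ∀ R Y : Finset (Fin N), R.card + Y.card = n → Disjoint R Y → ∀ x : Fin N → Fin d → ℝ,
      (∫⋯∫⁻_Y, (fun x => forestSum (vertexWeight β φ x) R Y) ∂fun _ => volume) x ≤
        (Y.card.factorial : ℝ≥0∞) * forestCoef (gCoef β φ) R.card Y.card := by
  induction n with
  | zero =>
    intro R Y h _ x
    obtain rfl : R = ∅ := Finset.card_eq_zero.1 (by omega)
    obtain rfl : Y = ∅ := Finset.card_eq_zero.1 (by omega)
    simpa [forestCoef_zero] using forestSum_empty_le (vertexWeight β φ x) ∅
  | succ n ih =>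
    intro R Y hn hRY x
    rcases R.eq_empty_or_nonempty with rfl | ⟨a, ha⟩
    · have hY : Y ≠ ∅ := by
        rintro rfl
        simp at hn
      have : (fun x => forestSum (vertexWeight β φ x) ∅ Y) = fun _ => 0 := by
        funext x
        simpa [hY] using forestSum_empty_le (vertexWeight β φ x) Y
      rw [this]
      simp [lmarginal]
    · have haY : a ∉ Y := Finset.disjoint_left.1 hRY ha
      obtain ⟨k, hk⟩ : ∃ k, R.card = k + 1 :=
        ⟨R.card - 1, by have := Finset.card_pos.2 ⟨a, ha⟩; omega⟩
      have hmeas : ∀ S : Finset (Fin N), Measurable fun x => vertexWeight β φ x a S *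
          forestSum (vertexWeight β φ x) (R.erase a ∪ S) (Y \ S) := fun S =>
        (measurable_vertexWeight β φ hφ a S).mul (measurable_forestSum β φ hφ _ _)
      have hterm : ∀ S ∈ Y.powerset,
          (∫⋯∫⁻_Y, (fun x => vertexWeight β φ x a S *
            forestSum (vertexWeight β φ x) (R.erase a ∪ S) (Y \ S)) ∂fun _ => volume) x ≤
          gCoef β φ S.card * (((Y.card - S.card).factorial : ℝ≥0∞) *
            forestCoef (gCoef β φ) (k + S.card) (Y.card - S.card)) := by
        intro S hS
        rw [Finset.mem_powerset] at hS
        have hcard : (Y \ S).card = Y.card - S.card := Finset.card_sdiff_of_subset hS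
        have hSle := Finset.card_le_card hS
        have hRS : (R.erase a ∪ S).card = k + S.card := by
          rw [Finset.card_union_of_disjoint (by
            rw [Finset.disjoint_left] at hRY ⊢
            grind), Finset.card_erase_of_mem ha, hk, Nat.add_sub_cancel]
        set K := ((Y.card - S.card).factorial : ℝ≥0∞) *
            forestCoef (gCoef β φ) (k + S.card) (Y.card - S.card) with hK
        have hinner : (∫⋯∫⁻_(Y \ S), (fun x => vertexWeight β φ x a S *
            forestSum (vertexWeight β φ x) (R.erase a ∪ S) (Y \ S)) ∂fun _ => volume) ≤
            fun x => vertexWeight β φ x a S * K := by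
          intro x
          have h1 := ih (R.erase a ∪ S) (Y \ S) (by omega) (by
            rw [Finset.disjoint_left] at hRY ⊢
            grind) x
          rw [hRS, hcard, ← hK] at h1
          refine le_trans (le_of_eq ?_) (mul_le_mul_right h1 (vertexWeight β φ x a S))
          unfold lmarginal
          refine Eq.trans (lintegral_congr fun y => ?_) (lintegral_const_mul _
            ((measurable_forestSum β φ hφ _ _).comp measurable_updateFinset))
          refine congrArg (· * _) ?_
          refine vertexWeight_congr β φ ?_ fun j hj => ?_
          · simp [Function.updateFinset, haY]
          · simp [Function.updateFinset, hj]
        have hY : Y = S ∪ (Y \ S) := (Finset.union_sdiff_of_subset hS).symm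
        calc _ = (∫⋯∫⁻_S, ∫⋯∫⁻_(Y \ S), (fun x => vertexWeight β φ x a S *
                forestSum (vertexWeight β φ x) (R.erase a ∪ S) (Y \ S)) ∂(fun _ => volume)
                  ∂fun _ => volume) x := by
              conv_lhs => rw [hY]
              rw [← lmarginal_union _ _ (hmeas S) Finset.disjoint_sdiff, ← hY]
          _ ≤ (∫⋯∫⁻_S, (fun x => vertexWeight β φ x a S * K) ∂fun _ => volume) x :=
              lmarginal_mono hinner x
          _ = (∫⋯∫⁻_S, (fun x => vertexWeight β φ x a S) ∂fun _ => volume) x * K :=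
              lintegral_mul_const _
                ((measurable_vertexWeight β φ hφ _ _).comp measurable_updateFinset)
          _ = gCoef β φ S.card * K := by
              rw [lmarginal_vertexWeight β φ S (fun h => haY (hS h))]
      calc (∫⋯∫⁻_Y, (fun x => forestSum (vertexWeight β φ x) R Y) ∂fun _ => volume) x
          ≤ (∫⋯∫⁻_Y, (fun x => ∑ S ∈ Y.powerset, vertexWeight β φ x a S *
              forestSum (vertexWeight β φ x) (R.erase a ∪ S) (Y \ S)) ∂fun _ => volume) x :=
            lmarginal_mono (fun x => forestSum_le (vertexWeight β φ x) hRY ha) x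
        _ = ∑ S ∈ Y.powerset, (∫⋯∫⁻_Y, (fun x => vertexWeight β φ x a S *
              forestSum (vertexWeight β φ x) (R.erase a ∪ S) (Y \ S)) ∂fun _ => volume) x :=
            lintegral_finsetSum _ fun S _ => (hmeas S).comp measurable_updateFinset
        _ ≤ ∑ S ∈ Y.powerset, gCoef β φ S.card * (((Y.card - S.card).factorial : ℝ≥0∞) *
              forestCoef (gCoef β φ) (k + S.card) (Y.card - S.card)) :=
            Finset.sum_le_sum hterm
        _ = (Y.card.factorial : ℝ≥0∞) * forestCoef (gCoef β φ) R.card Y.card := by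
            rw [Finset.sum_powerset_apply_card (fun s => gCoef β φ s *
              (((Y.card - s).factorial : ℝ≥0∞) *
                forestCoef (gCoef β φ) (k + s) (Y.card - s))), hk, forestCoef_succ,
              Finset.mul_sum]
            refine Finset.sum_congr rfl fun s hs => ?_
            have hs' : s ≤ Y.card := Nat.lt_succ_iff.1 (Finset.mem_range.1 hs)
            have hf : (s.factorial : ℝ≥0∞) ≠ 0 := by exact_mod_cast s.factorial_ne_zero
            rw [← Nat.choose_mul_factorial_mul_factorial hs', nsmul_eq_mul, div_eq_mul_inv]
            push_cast
            calc _ = (s.factorial * (s.factorial : ℝ≥0∞)⁻¹) * ((Y.card.choose s : ℝ≥0∞) *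
                  (gCoef β φ s * (((Y.card - s).factorial : ℝ≥0∞) *
                    forestCoef (gCoef β φ) (k + s) (Y.card - s)))) := by
                  rw [ENNReal.mul_inv_cancel hf (ENNReal.natCast_ne_top _), one_mul]
              _ = _ := by ring

lemma ofReal_treeB_le (hβ : 0 < β) (n : ℕ) (x : Fin (n + 1) → Fin d → ℝ) :
    ENNReal.ofReal (treeB (pairW β φ) n x) ≤
      forestSum (vertexWeight β φ x) {0} (Finset.univ.erase 0) := by
  refine le_trans (le_of_eq ?_) (sum_isTree_le_forestSum (vertexWeight β φ x))
  have hprod : ∀ τ : SimpleGraph (Fin (n + 1)),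
      0 ≤ ∏ i, phiFinset (pairW β φ) (x i) (childrenF τ i) x := fun τ =>
    Finset.prod_nonneg fun _ _ => phiFinset_nonneg β φ hβ _ _ _
  rw [treeB, ← Finset.sum_filter, ENNReal.ofReal_sum_of_nonneg fun τ _ => hprod τ]
  exact Finset.sum_congr rfl fun τ _ =>
    ENNReal.ofReal_prod_of_nonneg fun _ _ => phiFinset_nonneg β φ hβ _ _ _

lemma lintegral_treeB_le (hβ : 0 < β) (hφ : Measurable φ) (n : ℕ) :
    ∫⁻ y : Fin n → Fin d → ℝ, ENNReal.ofReal (treeB (pairW β φ) n (Fin.cons 0 y)) ≤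
      (n.factorial : ℝ≥0∞) * forestCoef (gCoef β φ) 1 n := by
  have h := lmarginal_forestSum_le β φ hφ _ {0} (Finset.univ.erase (0 : Fin (n + 1))) rfl
    (by simp) 0
  let e : Fin n ≃ ↥(Finset.univ.erase (0 : Fin (n + 1))) :=
    (finSuccAboveEquiv 0).trans (Equiv.subtypeEquivRight (by simp))
  rw [lmarginal_eq_lintegral _ e, Finset.card_erase_of_mem (Finset.mem_univ _),
    Finset.card_univ, Fintype.card_fin, Nat.add_sub_cancel, Finset.card_singleton] at h
  refine le_trans (lintegral_mono fun y => ?_) h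
  have hy : Function.updateFinset (0 : Fin (n + 1) → Fin d → ℝ) (Finset.univ.erase 0)
      (fun i => y (e.symm i)) = Fin.cons 0 y := by
    funext i
    refine Fin.cases ?_ (fun j => ?_) i
    · simp [Function.updateFinset]
    · have hj : j.succ ∈ Finset.univ.erase (0 : Fin (n + 1)) := by simp [Fin.succ_ne_zero]
      have hej : (⟨j.succ, hj⟩ : ↥(Finset.univ.erase (0 : Fin (n + 1)))) = e j := by
        ext
        simp [e, finSuccAboveEquiv_apply]
      rw [Function.updateFinset, dif_pos hj, hej, e.symm_apply_apply, Fin.cons_succ]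
  rw [hy]
  exact ofReal_treeB_le β φ hβ n _

lemma gCoef_zero : gCoef β φ 0 = 1 := by
  simp [gCoef, phiVertex, volume_pi]

lemma vertexSum_eq_tsum (t : ℝ≥0∞) :
    vertexSum β φ t = ∑' n : ℕ, gCoef β φ n * t ^ n / (n.factorial : ℝ≥0∞) := by
  rw [tsum_eq_zero_add' ENNReal.summable, vertexSum]
  simp [gCoef_zero]

lemma vertexSum_mono : Monotone (vertexSum β φ) := by
  intro s t h
  unfold vertexSum
  gcongr

lemma PiMap_mono (z : ℂ) : Monotone (PiMap β φ z) := fun _ _ h =>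
  mul_le_mul_right (vertexSum_mono β φ h) _

/-- The tree sum is bounded by every supersolution of the fixed-point equation. -/
lemma mul_treeSum_le (hβ : 0 < β) (hφ : Measurable φ) {r : ℝ} (hr : 0 ≤ r) {L : ℝ≥0∞}
    (hL : ENNReal.ofReal r * vertexSum β φ L ≤ L) :
    ENNReal.ofReal r * treeSum β φ r ≤ L := by
  rw [vertexSum_eq_tsum] at hL
  have hbound := fun N => sum_forestCoef_le (gCoef β φ) (ENNReal.ofReal r) L hL N 1
  have hterm : ∀ n : ℕ, ENNReal.ofReal (r ^ n / n.factorial) *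
      ∫⁻ y : Fin n → Fin d → ℝ, ENNReal.ofReal (treeB (pairW β φ) n (Fin.cons 0 y)) ≤
      forestCoef (gCoef β φ) 1 n * ENNReal.ofReal r ^ n := by
    intro n
    have hf : (n.factorial : ℝ≥0∞) ≠ 0 := by exact_mod_cast n.factorial_ne_zero
    have hn : (0 : ℝ) < n.factorial := by exact_mod_cast n.factorial_pos
    rw [ENNReal.ofReal_div_of_pos hn, ENNReal.ofReal_natCast, ENNReal.ofReal_pow hr]
    refine (mul_le_mul_right (lintegral_treeB_le β φ hβ hφ n) _).trans (le_of_eq ?_)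
    rw [div_eq_mul_inv]
    calc _ = ((n.factorial : ℝ≥0∞) * (n.factorial : ℝ≥0∞)⁻¹) *
          (forestCoef (gCoef β φ) 1 n * ENNReal.ofReal r ^ n) := by ring
      _ = _ := by rw [ENNReal.mul_inv_cancel hf (ENNReal.natCast_ne_top _), one_mul]
  have h0 : forestCoef (gCoef β φ) 1 0 = 1 := by
    rw [forestCoef_succ]
    simp [forestCoef_zero, gCoef_zero]
  have hsum : treeSum β φ r ≤ ∑' n : ℕ, forestCoef (gCoef β φ) 1 n * ENNReal.ofReal r ^ n := by
    rw [tsum_eq_zero_add' ENNReal.summable, h0, pow_zero, one_mul, treeSum]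
    exact add_le_add_right (ENNReal.tsum_le_tsum fun n => hterm (n + 1)) 1
  refine (mul_le_mul_right hsum _).trans ?_
  rw [← ENNReal.tsum_mul_left]
  refine ENNReal.tsum_le_of_sum_range_le fun N => ?_
  have h := hbound (N + 1)
  rw [Nat.add_sub_cancel, pow_one] at h
  refine le_trans (le_of_eq (Finset.sum_congr rfl fun n _ => ?_)) h
  rw [pow_add, pow_one]
  ring

/-- Continuity of the vertex sum along sequences dominated by a point where it is finite. -/
lemma tendsto_vertexSum {M L : ℝ≥0∞} (hM0 : M ≠ 0) (hM : vertexSum β φ M ≠ ∞)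
    {u : ℕ → ℝ≥0∞} (hu : ∀ n, u n ≤ M) (hlim : Filter.Tendsto u Filter.atTop (nhds L)) :
    Filter.Tendsto (fun n => vertexSum β φ (u n)) Filter.atTop (nhds (vertexSum β φ L)) := by
  have hg : ∀ k, gCoef β φ k ≠ ∞ := by
    intro k hk
    refine hM (top_unique ?_)
    rw [vertexSum_eq_tsum]
    refine le_trans (le_of_eq ?_) (ENNReal.le_tsum k)
    rw [hk, ENNReal.top_mul (pow_ne_zero _ hM0), ENNReal.top_div_of_ne_top (natCast_ne_top _)]
  simp only [vertexSum_eq_tsum, ← lintegral_count] at hM ⊢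
  refine tendsto_lintegral_of_dominated_convergence
    (fun k => gCoef β φ k * M ^ k / (k.factorial : ℝ≥0∞)) (fun n => measurable_of_countable _)
    (fun n => Filter.Eventually.of_forall fun k => ?_) hM (Filter.Eventually.of_forall fun k => ?_)
  · dsimp only
    gcongr
    exact hu n
  · have hf : (k.factorial : ℝ≥0∞) ≠ 0 := by exact_mod_cast k.factorial_ne_zero
    exact ENNReal.Tendsto.div_const
      (ENNReal.Tendsto.const_mul (ENNReal.Tendsto.pow hlim) (Or.inr (hg k))) (Or.inr hf)

end Weights

theorem statement4 {d : ℕ} (hd : 1 ≤ d) (β : ℝ) (hβ : 0 < β)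
    (φ : (Fin d → ℝ) → ℝ≥0∞) (hφm : Measurable φ) (hφeven : ∀ v, φ (-v) = φ v)
    (hT : ∫⁻ v : Fin d → ℝ, ENNReal.ofReal (1 - pairW β φ v 0) < ∞)
    (z : ℂ) (μ : ℝ) (hμ : 0 < μ)
    (hz : ENNReal.ofReal ‖z‖ ≤ ENNReal.ofReal μ / vertexSum β φ (ENNReal.ofReal μ)) :
    (∀ n : ℕ, (PiMap β φ z)^[n + 1] (ENNReal.ofReal μ)
        ≤ (PiMap β φ z)^[n] (ENNReal.ofReal μ)) ∧
    Filter.Tendsto (fun n : ℕ => (PiMap β φ z)^[n] (ENNReal.ofReal μ)) Filter.atTop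
      (nhds (⨅ n : ℕ, (PiMap β φ z)^[n] (ENNReal.ofReal μ))) ∧
    PiMap β φ z (⨅ n : ℕ, (PiMap β φ z)^[n] (ENNReal.ofReal μ))
      = ⨅ n : ℕ, (PiMap β φ z)^[n] (ENNReal.ofReal μ) ∧
    ENNReal.ofReal ‖z‖ * treeSum β φ ‖z‖
      ≤ ⨅ n : ℕ, (PiMap β φ z)^[n] (ENNReal.ofReal μ) ∧
    (∀ n : ℕ, (⨅ m : ℕ, (PiMap β φ z)^[m] (ENNReal.ofReal μ))
        ≤ (PiMap β φ z)^[n] (ENNReal.ofReal μ)) ∧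
    PiMap β φ z (ENNReal.ofReal μ) ≤ ENNReal.ofReal μ := by
  set M := ENNReal.ofReal μ with hMdef
  set P := PiMap β φ z with hP
  have hM0 : M ≠ 0 := (ENNReal.ofReal_pos.2 hμ).ne'
  have hmono : Monotone P := PiMap_mono β φ z
  have hPM : P M ≤ M := ENNReal.mul_le_of_le_div hz
  have hanti : Antitone fun n : ℕ => P^[n] M := hmono.antitone_iterate_of_map_le hPM
  have hlim : Filter.Tendsto (fun n : ℕ => P^[n] M) Filter.atTop (nhds (⨅ n : ℕ, P^[n] M)) :=
    tendsto_atTop_iInf hanti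
  have hfix : P (⨅ n : ℕ, P^[n] M) = ⨅ n : ℕ, P^[n] M := by
    have hsucc : Filter.Tendsto (fun n : ℕ => P (P^[n] M)) Filter.atTop
        (nhds (⨅ n : ℕ, P^[n] M)) := by
      simpa only [Function.comp_def, Function.iterate_succ_apply'] using
        hlim.comp (Filter.tendsto_add_atTop_nat 1)
    refine tendsto_nhds_unique ?_ hsucc
    rcases eq_or_ne (vertexSum β φ M) ∞ with hΨ | hΨ
    · have hz0 : ENNReal.ofReal ‖z‖ = 0 := by simpa [hΨ] using hz
      simp only [hP, PiMap, hz0, zero_mul]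
      exact tendsto_const_nhds
    · exact ENNReal.Tendsto.const_mul
        (tendsto_vertexSum β φ hM0 hΨ (fun n => hanti (Nat.zero_le n)) hlim)
        (Or.inr ENNReal.ofReal_ne_top)
  exact ⟨fun n => hanti n.le_succ, hlim, hfix,
    mul_treeSum_le β φ hβ hφm (norm_nonneg z) hfix.le, fun n => iInf_le _ n, hPM⟩
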